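/- Fix α ∈ (0,1) and p ≥ 1. Assume Y = m₁(X) + m₂(X)ε where X is an ℝ^d-valued random vector independent of the real random variable ε, m₁ : ℝ^d → ℝ and m₂ : ℝ^d → (0,∞) are Lipschitz with constants [m₁]_Lip and [m₂]_Lip, E[|X|^p] < ∞ and E[|ε|^p] < ∞; set [m]_Lip = [m₁]_Lip + [m₂]_Lip·(E[|ε|^p])^{1/p}. Let γ ⊂ ℝ^d be any finite grid whose cells all have positive P_X-mass, let X̃ = Proj_γ(X), G̃_a(c) = E[ρ_α(Y−a)·1_{Proj_γ(X)=c}]/P(Proj_γ(X)=c) for a grid point c, and G_a(x) = E[ρ_α(m₁(x)+m₂(x)ε − a)]. Then ( E[ | inf_{a∈ℝ} G̃_a(X̃) − inf_{a∈ℝ} G_a(X) |^p ] )^{1/p} ≤ 2·max(α,1−α)·[m]_Lip·( E[|X̃ − X|^p] )^{1/p}. -/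

import Mathlib

open MeasureTheory ProbabilityTheory Filter

/-- The `p`-th power `L_p`-quantization error of a measure `μ` on `ℝ^d` for a grid `γ`:
`∫ dist(z,γ)^p dμ(z)`. -/
noncomputable def qErr {d : ℕ} (μ : Measure (EuclideanSpace ℝ (Fin d))) (p : ℝ)
    (γ : Set (EuclideanSpace ℝ (Fin d))) : ℝ :=
  ∫ z, Metric.infDist z γ ^ p ∂μ

/-- `γ` is an `L_p`-optimal `N`-grid for (the law) `μ`: a nonempty set of at most `N` points
minimizing the quantization error among all such grids. -/
def IsOptimalGrid {d : ℕ} (μ : Measure (EuclideanSpace ℝ (Fin d))) (p : ℝ) (N : ℕ)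
    (γ : Finset (EuclideanSpace ℝ (Fin d))) : Prop :=
  γ.Nonempty ∧ γ.card ≤ N ∧
    ∀ γ' : Finset (EuclideanSpace ℝ (Fin d)), γ'.Nonempty → γ'.card ≤ N →
      qErr μ p ↑γ ≤ qErr μ p ↑γ'

/-- `proj` is a measurable nearest-point projection onto the finite grid `γ`. -/
def IsNearestProj {d : ℕ} (γ : Finset (EuclideanSpace ℝ (Fin d)))
    (proj : EuclideanSpace ℝ (Fin d) → EuclideanSpace ℝ (Fin d)) : Prop :=
  Measurable proj ∧ ∀ z, proj z ∈ γ ∧ dist z (proj z) = Metric.infDist z ↑γ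

/-- The (topological) support of a measure on `ℝ^d`: points all of whose neighbourhoods have
positive mass. -/
def msupport {d : ℕ} (μ : Measure (EuclideanSpace ℝ (Fin d))) :
    Set (EuclideanSpace ℝ (Fin d)) :=
  {x | ∀ r > 0, 0 < μ (Metric.ball x r)}

/-- The check (pinball) function `ρ_α(z) = z(α − 1_{z<0})`. -/
noncomputable def checkFn (α z : ℝ) : ℝ := z * (α - if z < 0 then 1 else 0)

/-- `G_a(x) = E[ρ_α(m₁(x)+m₂(x)ε−a)]`. -/
noncomputable def Gfun {d : ℕ} {Ω : Type*} [MeasurableSpace Ω] (P : Measure Ω) (ε : Ω → ℝ)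
    (m₁ m₂ : EuclideanSpace ℝ (Fin d) → ℝ) (α a : ℝ) (x : EuclideanSpace ℝ (Fin d)) : ℝ :=
  ∫ ω, checkFn α (m₁ x + m₂ x * ε ω - a) ∂P

/-- `G̃_a(c) = E[ρ_α(Y−a)·1_{Proj_γ(X)=c}] / P(Proj_γ(X)=c)`, the conditional expectation of
`ρ_α(Y−a)` given that the quantized covariate equals the grid point `c`. -/
noncomputable def Gtil {d : ℕ} {Ω : Type*} [MeasurableSpace Ω] (P : Measure Ω) (Y : Ω → ℝ)
    (X : Ω → EuclideanSpace ℝ (Fin d))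
    (proj : EuclideanSpace ℝ (Fin d) → EuclideanSpace ℝ (Fin d))
    (α a : ℝ) (c : EuclideanSpace ℝ (Fin d)) : ℝ :=
  (∫ ω, Set.indicator {ω' | proj (X ω') = c} (fun ω' => checkFn α (Y ω' - a)) ω ∂P) /
    (P {ω' | proj (X ω') = c}).toReal

lemma checkFn_eq_max (α z : ℝ) : checkFn α z = max (α * z) ((α - 1) * z) := by
  unfold checkFn
  split_ifs with h
  · rw [max_eq_right (by nlinarith)]; ring
  · rw [max_eq_left (by nlinarith)]; ring

lemma checkFn_lip {α : ℝ} (hα : α ∈ Set.Ioo (0:ℝ) 1) (x y : ℝ) :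
    |checkFn α x - checkFn α y| ≤ max α (1 - α) * |x - y| := by
  rw [checkFn_eq_max, checkFn_eq_max]
  refine (abs_max_sub_max_le_max _ _ _ _).trans ?_
  rw [← mul_sub, ← mul_sub, abs_mul, abs_mul, abs_of_pos hα.1,
    abs_of_neg (show α - 1 < 0 by linarith [hα.2])]
  apply max_le
  · gcongr; exact le_max_left _ _
  · gcongr; rw [neg_sub]; exact le_max_right _ _

lemma checkFn_nonneg {α : ℝ} (hα : α ∈ Set.Ioo (0:ℝ) 1) (x : ℝ) : 0 ≤ checkFn α x := by
  rw [checkFn_eq_max]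
  rcases le_total 0 x with h | h
  · exact le_max_of_le_left (mul_nonneg hα.1.le h)
  · exact le_max_of_le_right (mul_nonneg_of_nonpos_of_nonpos (by linarith [hα.2]) h)

lemma measurable_checkFn (α : ℝ) : Measurable (checkFn α) := by
  have : checkFn α = fun z => max (α * z) ((α - 1) * z) := funext (checkFn_eq_max α)
  rw [this]; fun_prop

lemma integrable_checkFn {Ω : Type*} [MeasurableSpace Ω] {P : Measure Ω} {α : ℝ}
    (hα : α ∈ Set.Ioo (0:ℝ) 1) {f : Ω → ℝ} (hf : Integrable f P) :
    Integrable (fun ω => checkFn α (f ω)) P := by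
  refine (hf.norm.const_mul (max α (1 - α))).mono'
    ((measurable_checkFn α).comp_aemeasurable hf.aemeasurable).aestronglyMeasurable
    (Eventually.of_forall fun ω => ?_)
  have := checkFn_lip hα (f ω) 0
  simpa [checkFn] using this

lemma abs_iInf_sub_iInf_le {f g : ℝ → ℝ} {B : ℝ} (hf : ∀ a, 0 ≤ f a) (hg : ∀ a, 0 ≤ g a)
    (h : ∀ a, |f a - g a| ≤ B) : |(⨅ a, f a) - (⨅ a, g a)| ≤ B := by
  have bf : BddBelow (Set.range f) := ⟨0, by rintro _ ⟨a, rfl⟩; exact hf a⟩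
  have bg : BddBelow (Set.range g) := ⟨0, by rintro _ ⟨a, rfl⟩; exact hg a⟩
  rw [abs_le]
  constructor
  · have : (⨅ a, g a) - B ≤ ⨅ a, f a := le_ciInf fun a => by
      have := ciInf_le bg a
      have := abs_le.1 (h a)
      linarith
    linarith
  · have : (⨅ a, f a) - B ≤ ⨅ a, g a := le_ciInf fun a => by
      have := ciInf_le bf a
      have := abs_le.1 (h a)
      linarith
    linarith

section
variable {d : ℕ} {α : ℝ} {Ω : Type*} [MeasurableSpace Ω] {P : Measure Ω} [IsProbabilityMeasure P]
    {X : Ω → EuclideanSpace ℝ (Fin d)} {ε : Ω → ℝ}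
    {m₁ m₂ : EuclideanSpace ℝ (Fin d) → ℝ} {K₁ K₂ : NNReal}

lemma checkFn_model_sub (hα : α ∈ Set.Ioo (0:ℝ) 1)
    (h₁ : LipschitzWith K₁ m₁) (h₂ : LipschitzWith K₂ m₂) (a e : ℝ)
    (x c : EuclideanSpace ℝ (Fin d)) :
    |checkFn α (m₁ x + m₂ x * e - a) - checkFn α (m₁ c + m₂ c * e - a)| ≤
      max α (1 - α) * (K₁ * ‖c - x‖ + K₂ * (‖c - x‖ * |e|)) := by
  refine (checkFn_lip hα _ _).trans ?_
  have hL : 0 ≤ max α (1 - α) := le_max_of_le_left hα.1.le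
  gcongr
  have e1 : m₁ x + m₂ x * e - a - (m₁ c + m₂ c * e - a) = (m₁ x - m₁ c) + (m₂ x - m₂ c) * e := by
    ring
  rw [e1]
  refine (abs_add_le _ _).trans ?_
  have l1 := h₁.dist_le_mul x c
  have l2 := h₂.dist_le_mul x c
  rw [Real.dist_eq, dist_eq_norm, norm_sub_rev] at l1 l2
  rw [abs_mul, ← mul_assoc]
  gcongr

lemma Gfun_sub_le (hα : α ∈ Set.Ioo (0:ℝ) 1) (hε : Integrable ε P)
    (h₁ : LipschitzWith K₁ m₁) (h₂ : LipschitzWith K₂ m₂) (a : ℝ)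
    (x c : EuclideanSpace ℝ (Fin d)) :
    |Gfun P ε m₁ m₂ α a x - Gfun P ε m₁ m₂ α a c| ≤
      max α (1 - α) * (K₁ + K₂ * ∫ ω, |ε ω| ∂P) * ‖c - x‖ := by
  have hi : ∀ z, Integrable (fun ω => checkFn α (m₁ z + m₂ z * ε ω - a)) P := fun z =>
    integrable_checkFn hα (((integrable_const _).add (hε.const_mul _)).sub (integrable_const _))
  have hε' : Integrable (fun ω => |ε ω|) P := hε.norm
  unfold Gfun
  rw [← integral_sub (hi x) (hi c)]
  refine (abs_integral_le_integral_abs).trans ?_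
  refine (integral_mono ((hi x).sub (hi c)).abs ?_
    (fun ω => checkFn_model_sub hα h₁ h₂ a (ε ω) x c)).trans ?_
  · exact ((integrable_const _).add ((hε'.const_mul _).const_mul _)).const_mul _
  · rw [integral_const_mul, integral_add (integrable_const _) ((hε'.const_mul _).const_mul _),
      integral_const_mul ((K₂:ℝ)), integral_const_mul]
    simp only [integral_const_mul, integral_const, probReal_univ, smul_eq_mul, one_mul]
    apply le_of_eq; ring

lemma Gtil_sub_le (hα : α ∈ Set.Ioo (0:ℝ) 1) (hXm : Measurable X) (hεm : Measurable ε)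
    (hindep : IndepFun X ε P)
    (hX : Integrable X P) (hε : Integrable ε P)
    (h₁ : LipschitzWith K₁ m₁) (h₂ : LipschitzWith K₂ m₂)
    {Y : Ω → ℝ} (hY : ∀ ω, Y ω = m₁ (X ω) + m₂ (X ω) * ε ω)
    {proj : EuclideanSpace ℝ (Fin d) → EuclideanSpace ℝ (Fin d)} (hpm : Measurable proj)
    (a : ℝ) (c : EuclideanSpace ℝ (Fin d)) (hmass : 0 < P {ω | proj (X ω) = c}) :
    |Gtil P Y X proj α a c - Gfun P ε m₁ m₂ α a c| ≤
      max α (1 - α) * (K₁ + K₂ * ∫ ω, |ε ω| ∂P) *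
        ((∫ ω in {ω | proj (X ω) = c}, ‖c - X ω‖ ∂P) / (P {ω | proj (X ω) = c}).toReal) := by
  set B : Set (EuclideanSpace ℝ (Fin d)) := proj ⁻¹' {c} with hB
  have hBm : MeasurableSet B := hpm (measurableSet_singleton c)
  set A : Set Ω := {ω | proj (X ω) = c} with hA
  have hAB : A = X ⁻¹' B := rfl
  have hAm : MeasurableSet A := hXm hBm
  set q : ℝ := (P A).toReal with hq
  have hqpos : 0 < q := ENNReal.toReal_pos hmass.ne' (measure_ne_top _ _)
  have hε' : Integrable (fun ω => |ε ω|) P := hε.norm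
  have hcX : Integrable (fun ω => ‖c - X ω‖) P := ((integrable_const c).sub hX).norm
  have hlip : ∀ {K : NNReal} {m : EuclideanSpace ℝ (Fin d) → ℝ}, LipschitzWith K m →
      Integrable (fun ω => m (X ω)) P := by
    intro K m hm
    have : Integrable (fun ω => |m c| + K * ‖c - X ω‖) P :=
      (integrable_const _).add (hcX.const_mul _)
    refine this.mono' (hm.continuous.measurable.comp hXm).aestronglyMeasurable
      (Eventually.of_forall fun ω => ?_)
    have l := hm.dist_le_mul (X ω) c
    rw [Real.dist_eq, dist_eq_norm, norm_sub_rev] at l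
    have := abs_sub_abs_le_abs_sub (m (X ω)) (m c)
    rw [Real.norm_eq_abs]; linarith
  have hm2 : Integrable (fun ω => m₂ (X ω) * ε ω) P :=
    (hindep.comp h₂.continuous.measurable measurable_id).integrable_mul (hlip h₂) hε
  have hYi : Integrable (fun ω => checkFn α (Y ω - a)) P := by
    refine integrable_checkFn hα ?_
    simp_rw [hY]
    exact ((hlip h₁).add hm2).sub (integrable_const _)
  have hci : Integrable (fun ω => checkFn α (m₁ c + m₂ c * ε ω - a)) P :=
    integrable_checkFn hα (((integrable_const _).add (hε.const_mul _)).sub (integrable_const _))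
  -- independence
  have hfac : ∀ {u : EuclideanSpace ℝ (Fin d) → ℝ} {v : ℝ → ℝ}, Measurable u → Measurable v →
      ∫ ω in A, u (X ω) * v (ε ω) ∂P = (∫ ω in A, u (X ω) ∂P) * ∫ ω, v (ε ω) ∂P := by
    intro u v hu hv
    have hu' : Measurable (B.indicator u) := hu.indicator hBm
    have := (hindep.comp hu' hv).integral_fun_mul_eq_mul_integral
      (hu'.comp hXm).aestronglyMeasurable (hv.comp hεm).aestronglyMeasurable
    rw [← integral_indicator hAm, ← integral_indicator hAm]
    convert this using 1
    · congr 1; ext ω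
      by_cases h : ω ∈ A
      · have h' : X ω ∈ B := h
        simp [h, h']
      · have h' : X ω ∉ B := h
        simp [h, h']
    · have : A.indicator (fun ω => u (X ω)) = B.indicator u ∘ X := by
        ext ω
        by_cases h : ω ∈ A
        · have h' : X ω ∈ B := h
          simp [h, h']
        · have h' : X ω ∉ B := h
          simp [h, h']
      rw [this]; rfl
  have hGc : ∫ ω in A, checkFn α (m₁ c + m₂ c * ε ω - a) ∂P = q * Gfun P ε m₁ m₂ α a c := by
    have := hfac (u := fun _ => 1) (v := fun e => checkFn α (m₁ c + m₂ c * e - a))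
      measurable_const ((measurable_checkFn α).comp (by fun_prop))
    simpa [Gfun, Measure.real] using this
  have hprod : ∫ ω in A, ‖c - X ω‖ * |ε ω| ∂P = (∫ ω in A, ‖c - X ω‖ ∂P) * ∫ ω, |ε ω| ∂P :=
    hfac (u := fun x => ‖c - x‖) (v := fun e => |e|) (by fun_prop) (by fun_prop)
  have hpi : Integrable (fun ω => ‖c - X ω‖ * |ε ω|) P :=
    (hindep.comp (φ := fun x => ‖c - x‖) (ψ := fun e => |e|)
      (by fun_prop) (by fun_prop)).integrable_mul hcX hε'
  have key : |(∫ ω in A, checkFn α (Y ω - a) ∂P) - q * Gfun P ε m₁ m₂ α a c| ≤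
      max α (1 - α) * (K₁ + K₂ * ∫ ω, |ε ω| ∂P) * ∫ ω in A, ‖c - X ω‖ ∂P := by
    rw [← hGc, ← integral_sub hYi.integrableOn hci.integrableOn]
    refine (abs_integral_le_integral_abs).trans ?_
    have i1 : Integrable (fun ω => (K₁:ℝ) * ‖c - X ω‖) (P.restrict A) :=
      (hcX.const_mul _).integrableOn
    have i2 : Integrable (fun ω => (K₂:ℝ) * (‖c - X ω‖ * |ε ω|)) (P.restrict A) :=
      (hpi.const_mul _).integrableOn
    refine (integral_mono (hYi.integrableOn.sub hci.integrableOn).abs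
      ((i1.add i2).const_mul (max α (1 - α))) (fun ω => ?_)).trans ?_
    · have := checkFn_model_sub hα h₁ h₂ a (ε ω) (X ω) c
      rw [← hY] at this
      exact this
    · have : ∫ ω in A, max α (1 - α) * ((K₁:ℝ) * ‖c - X ω‖ + K₂ * (‖c - X ω‖ * |ε ω|)) ∂P
        = max α (1 - α) * (K₁ + K₂ * ∫ ω, |ε ω| ∂P) * ∫ ω in A, ‖c - X ω‖ ∂P := by
        rw [integral_const_mul, integral_add i1 i2, integral_const_mul, integral_const_mul, hprod]
        ring
      exact this.le
  have e : Gtil P Y X proj α a c - Gfun P ε m₁ m₂ α a c =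
      ((∫ ω in A, checkFn α (Y ω - a) ∂P) - q * Gfun P ε m₁ m₂ α a c) / q := by
    unfold Gtil
    rw [integral_indicator hAm, ← hA, ← hq, sub_div, mul_div_cancel_left₀ _ hqpos.ne']
  rw [e, abs_div, abs_of_pos hqpos, ← mul_div_assoc]
  gcongr

end

/-- STATEMENT 12: in the location-scale model `Y = m₁(X) + m₂(X)ε`, for any finite grid `γ`
with nearest-point projection `proj` all of whose cells have positive mass,
`‖inf_{a∈ℝ} G̃_a(X̃) − inf_{a∈ℝ} G_a(X)‖_{L^p} ≤ 2·max(α,1−α)·[m]_Lip·‖X̃ − X‖_{L^p}`, where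
`[m]_Lip = K₁ + K₂·(E[|ε|^p])^{1/p}` and `X̃ = proj ∘ X`. -/
theorem Lp_inf_Gtil_sub_inf_Gfun_le {d : ℕ} (hd : 1 ≤ d) (α p : ℝ)
    (hα : α ∈ Set.Ioo (0:ℝ) 1) (hp : 1 ≤ p)
    {Ω : Type*} [MeasurableSpace Ω] (P : Measure Ω) [IsProbabilityMeasure P]
    (X : Ω → EuclideanSpace ℝ (Fin d)) (ε : Ω → ℝ) (hXm : Measurable X) (hεm : Measurable ε)
    (hindep : IndepFun X ε P)
    (m₁ m₂ : EuclideanSpace ℝ (Fin d) → ℝ) (K₁ K₂ : NNReal)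
    (h₁ : LipschitzWith K₁ m₁) (h₂ : LipschitzWith K₂ m₂) (h₂pos : ∀ x, 0 < m₂ x)
    (hXmom : Integrable (fun ω => ‖X ω‖ ^ p) P)
    (hεmom : Integrable (fun ω => |ε ω| ^ p) P)
    (Y : Ω → ℝ) (hY : ∀ ω, Y ω = m₁ (X ω) + m₂ (X ω) * ε ω)
    (γ : Finset (EuclideanSpace ℝ (Fin d)))
    (proj : EuclideanSpace ℝ (Fin d) → EuclideanSpace ℝ (Fin d))
    (hproj : IsNearestProj γ proj)
    (hmass : ∀ c ∈ γ, 0 < P {ω | proj (X ω) = c}) :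
    (∫ ω, |(⨅ a : ℝ, Gtil P Y X proj α a (proj (X ω))) -
          (⨅ a : ℝ, Gfun P ε m₁ m₂ α a (X ω))| ^ p ∂P) ^ (1 / p) ≤
      2 * max α (1 - α) * ((K₁ : ℝ) + (K₂ : ℝ) * (∫ ω, |ε ω| ^ p ∂P) ^ (1 / p)) *
        (∫ ω, ‖proj (X ω) - X ω‖ ^ p ∂P) ^ (1 / p) := by
  have hp0 : 0 < p := by linarith
  obtain ⟨hpm, hpr⟩ := hproj
  have hpe0 : ENNReal.ofReal p ≠ 0 := by simpa using hp0
  have hpe1 : (1 : ENNReal) ≤ ENNReal.ofReal p := by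
    rw [← ENNReal.ofReal_one]; exact ENNReal.ofReal_le_ofReal hp
  have htr : (ENNReal.ofReal p).toReal = p := ENNReal.toReal_ofReal hp0.le
  have hXL : MemLp X (ENNReal.ofReal p) P := by
    rw [← integrable_norm_rpow_iff hXm.aestronglyMeasurable hpe0 ENNReal.ofReal_ne_top, htr]
    exact hXmom
  have hεL : MemLp ε (ENNReal.ofReal p) P := by
    rw [← integrable_norm_rpow_iff hεm.aestronglyMeasurable hpe0 ENNReal.ofReal_ne_top, htr]
    exact hεmom
  have hpXL : MemLp (fun ω => proj (X ω)) (ENNReal.ofReal p) P := by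
    refine MemLp.of_bound (hpm.comp hXm).aestronglyMeasurable (∑ c ∈ γ, ‖c‖)
      (Eventually.of_forall fun ω => ?_)
    exact Finset.single_le_sum (f := fun c => ‖c‖) (fun c _ => norm_nonneg c) (hpr (X ω)).1
  have hDL := hpXL.sub hXL
  have hX : Integrable X P := hXL.integrable hpe1
  have hε : Integrable ε P := hεL.integrable hpe1
  set D : Ω → ℝ := fun ω => ‖proj (X ω) - X ω‖ with hD
  have hD0 : ∀ ω, 0 ≤ D ω := fun ω => norm_nonneg _
  have hDi : Integrable D P := (hDL.integrable hpe1).norm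
  have hDp : Integrable (fun ω => D ω ^ p) P := by
    have := hDL.integrable_norm_rpow hpe0 ENNReal.ofReal_ne_top
    rwa [htr] at this
  set A : EuclideanSpace ℝ (Fin d) → Set Ω := fun c => {ω | proj (X ω) = c} with hA
  have hAm : ∀ c, MeasurableSet (A c) := fun c => (hpm.comp hXm) (measurableSet_singleton c)
  set g : EuclideanSpace ℝ (Fin d) → ℝ := fun c => (∫ ω in A c, D ω ∂P) / (P (A c)).toReal with hg
  have hg0 : ∀ c, 0 ≤ g c := fun c =>
    div_nonneg (integral_nonneg fun ω => hD0 ω) ENNReal.toReal_nonneg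
  set H : Ω → ℝ := fun ω => g (proj (X ω)) with hH
  have hdec : ∀ (f : Ω → ℝ), f = fun ω => ∑ c ∈ γ, (A c).indicator f ω := by
    intro f
    ext ω
    rw [Finset.sum_eq_single (proj (X ω))]
    · exact (Set.indicator_of_mem (show ω ∈ A (proj (X ω)) from rfl) f).symm
    · intro b _ hb
      have hn : ω ∉ A b := fun h => hb (Eq.symm h)
      exact Set.indicator_of_notMem hn f
    · intro h; exact absurd (hpr (X ω)).1 h
  have hHind : ∀ c, (A c).indicator (fun ω => H ω ^ p) = (A c).indicator (fun _ => g c ^ p) := by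
    intro c
    ext ω
    by_cases hω : ω ∈ A c
    · have : proj (X ω) = c := hω
      rw [Set.indicator_of_mem hω, Set.indicator_of_mem hω]
      simp only [hH, this]
    · rw [Set.indicator_of_notMem hω, Set.indicator_of_notMem hω]
  have hHi1 : ∀ c, Integrable ((A c).indicator (fun ω => H ω ^ p)) P := by
    intro c
    rw [hHind]
    exact (integrable_const _).indicator (hAm c)
  have hHp : Integrable (fun ω => H ω ^ p) P := by
    rw [hdec (fun ω => H ω ^ p)]
    exact integrable_finsetSum _ fun c _ => hHi1 c
  have hHD : ∫ ω, H ω ^ p ∂P ≤ ∫ ω, D ω ^ p ∂P := by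
    rw [hdec (fun ω => H ω ^ p), hdec (fun ω => D ω ^ p),
      integral_finsetSum _ (fun c _ => hHi1 c),
      integral_finsetSum _ (fun c _ => hDp.indicator (hAm c))]
    refine Finset.sum_le_sum fun c hc => ?_
    rw [hHind, integral_indicator (hAm c), integral_indicator (hAm c)]
    have hq : 0 < (P (A c)).toReal := ENNReal.toReal_pos (hmass c hc).ne' (measure_ne_top _ _)
    have J := (convexOn_rpow hp).map_set_average_le (μ := P) (t := A c) (f := D)
      (continuousOn_id.rpow_const fun x _ => Or.inr hp0.le) isClosed_Ici (hmass c hc).ne'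
      (measure_ne_top _ _) (Eventually.of_forall fun ω => hD0 ω) hDi.integrableOn
      hDp.integrableOn
    rw [setAverage_eq, setAverage_eq] at J
    simp only [smul_eq_mul, Measure.real] at J
    rw [← div_eq_inv_mul, ← div_eq_inv_mul, le_div_iff₀ hq] at J
    simp only [integral_const, smul_eq_mul, measureReal_restrict_apply_univ]
    rw [mul_comm]
    exact J
  set M : ℝ := max α (1 - α) * (K₁ + K₂ * ∫ ω, |ε ω| ∂P) with hM
  have hL : 0 ≤ max α (1 - α) := le_max_of_le_left hα.1.le
  have hE0 : 0 ≤ ∫ ω, |ε ω| ∂P := integral_nonneg fun ω => abs_nonneg _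
  have hM0 : 0 ≤ M := by positivity
  have hpt : ∀ ω, |(⨅ a : ℝ, Gtil P Y X proj α a (proj (X ω))) -
      (⨅ a : ℝ, Gfun P ε m₁ m₂ α a (X ω))| ≤ M * (H ω + D ω) := by
    intro ω
    refine abs_iInf_sub_iInf_le (fun a => ?_) (fun a => ?_) (fun a => ?_)
    · exact div_nonneg (integral_nonneg fun ω =>
        Set.indicator_nonneg (fun _ _ => checkFn_nonneg hα _) _) ENNReal.toReal_nonneg
    · exact integral_nonneg fun ω => checkFn_nonneg hα _
    · have t1 := Gtil_sub_le hα hXm hεm hindep hX hε h₁ h₂ hY hpm a (proj (X ω))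
        (hmass _ (hpr (X ω)).1)
      have t2 := Gfun_sub_le hα hε h₁ h₂ a (X ω) (proj (X ω))
      rw [abs_sub_comm] at t2
      have e : ∫ ω' in {ω' | proj (X ω') = proj (X ω)}, ‖proj (X ω) - X ω'‖ ∂P
          = ∫ ω' in A (proj (X ω)), D ω' ∂P := by
        refine setIntegral_congr_fun (hAm _) fun ω' hω' => ?_
        have : proj (X ω') = proj (X ω) := hω'
        simp only [hD, this]
      rw [e] at t1
      refine (abs_sub_le _ (Gfun P ε m₁ m₂ α a (proj (X ω))) _).trans ?_
      rw [mul_add]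
      exact add_le_add t1 t2
  have hmain : ∫ ω, |(⨅ a : ℝ, Gtil P Y X proj α a (proj (X ω))) -
      (⨅ a : ℝ, Gfun P ε m₁ m₂ α a (X ω))| ^ p ∂P ≤ (2 * M) ^ p * ∫ ω, D ω ^ p ∂P := by
    have hb : Integrable (fun ω => M ^ p * (2 ^ (p - 1) * (H ω ^ p + D ω ^ p))) P :=
      ((hHp.add hDp).const_mul _).const_mul _
    refine (integral_mono_of_nonneg (Eventually.of_forall fun ω => by positivity) hb
      (Eventually.of_forall fun ω => ?_)).trans ?_
    · refine (Real.rpow_le_rpow (abs_nonneg _) (hpt ω) hp0.le).trans ?_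
      have h0 : 0 ≤ H ω := hg0 _
      rw [Real.mul_rpow hM0 (add_nonneg h0 (hD0 ω))]
      refine mul_le_mul_of_nonneg_left ?_ (by positivity)
      have := NNReal.rpow_add_le_mul_rpow_add_rpow ⟨H ω, h0⟩ ⟨D ω, hD0 ω⟩ hp
      exact_mod_cast this
    · rw [integral_const_mul, integral_const_mul, integral_add hHp hDp,
        Real.mul_rpow (by norm_num) hM0]
      have h2 : (2:ℝ) ^ p = 2 ^ (p - 1) * 2 := by
        rw [← Real.rpow_add_one (by norm_num)]; ring_nf
      rw [h2]
      calc _ ≤ M ^ p * (2 ^ (p - 1) * (∫ ω, D ω ^ p ∂P + ∫ ω, D ω ^ p ∂P)) := by gcongr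
        _ = _ := by ring
  have hεp : ∫ ω, |ε ω| ∂P ≤ (∫ ω, |ε ω| ^ p ∂P) ^ (1 / p) := by
    have J := (convexOn_rpow hp).map_integral_le (μ := P) (f := fun ω => |ε ω|)
      (continuousOn_id.rpow_const fun x _ => Or.inr hp0.le) isClosed_Ici
      (Eventually.of_forall fun ω => Set.mem_Ici.2 (abs_nonneg (ε ω))) hε.norm hεmom
    calc _ = ((∫ ω, |ε ω| ∂P) ^ p) ^ (1 / p) := by
          rw [← Real.rpow_mul hE0, mul_one_div_cancel hp0.ne', Real.rpow_one]
      _ ≤ _ := Real.rpow_le_rpow (by positivity) J (by positivity)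
  have hDp0 : 0 ≤ ∫ ω, D ω ^ p ∂P := integral_nonneg fun ω => Real.rpow_nonneg (hD0 ω) _
  calc _ ≤ ((2 * M) ^ p * ∫ ω, D ω ^ p ∂P) ^ (1 / p) :=
        Real.rpow_le_rpow (integral_nonneg fun ω => by positivity) hmain (by positivity)
    _ = 2 * M * (∫ ω, D ω ^ p ∂P) ^ (1 / p) := by
        rw [Real.mul_rpow (by positivity) hDp0, ← Real.rpow_mul (by positivity),
          mul_one_div_cancel hp0.ne', Real.rpow_one]
    _ ≤ _ := by
        rw [hM, ← mul_assoc 2]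
        gcongr
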